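/- Let n ≥ 3 be an integer, let Q₁ and Q₂ be mutually orthogonal rank-one orthogonal projections in M_n(ℂ), and let Q₃ := I − Q₁ − Q₂. Then the subalgebra 𝒜 := ℂ(Q₁+Q₂) + Q₁·M_n(ℂ)·Q₂ + (Q₁+Q₂)·M_n(ℂ)·Q₃ = {α(Q₁+Q₂) + Q₁SQ₂ + (Q₁+Q₂)TQ₃ : α ∈ ℂ, S, T ∈ M_n(ℂ)} is idempotent compressible, and consequently its unitization 𝒜 + ℂI is idempotent compressible. -/

import Mathlib

open Matrix

abbrev Mat (n : ℕ) := Matrix (Fin n) (Fin n) ℂ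

/-- A set of matrices is closed under multiplication. -/
def MulClosed {n : ℕ} (S : Set (Mat n)) : Prop :=
  ∀ x ∈ S, ∀ y ∈ S, x * y ∈ S

/-- The compression `E 𝒜 E = {E A E : A ∈ 𝒜}` of a set of matrices by `E`. -/
def compress {n : ℕ} (E : Mat n) (A : Set (Mat n)) : Set (Mat n) :=
  (fun M => E * M * E) '' A

/-- `𝒜` is projection compressible: for every orthogonal projection `P`,
`P 𝒜 P` is closed under multiplication. -/
def ProjectionCompressible {n : ℕ} (A : Set (Mat n)) : Prop :=
  ∀ P : Mat n, P * P = P → Pᴴ = P → MulClosed (compress P A)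

/-- `𝒜` is idempotent compressible: for every idempotent `E`,
`E 𝒜 E` is closed under multiplication. -/
def IdempotentCompressible {n : ℕ} (A : Set (Mat n)) : Prop :=
  ∀ E : Mat n, E * E = E → MulClosed (compress E A)

/-- The unitization `𝒜 + ℂ I` of a set of matrices. -/
def unitization {n : ℕ} (A : Set (Mat n)) : Set (Mat n) :=
  {M | ∃ B ∈ A, ∃ α : ℂ, M = B + α • (1 : Mat n)}

/-- The matrices `u ⊗ r + v ⊗ s` with range in the span of `u, v` whose compression to that span
is upper triangular with constant diagonal. -/
def triangularSet {n : ℕ} (u v : Fin n → ℂ) : Set (Mat n) :=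
  {M | ∃ r s : Fin n → ℂ, M = vecMulVec u r + vecMulVec v s ∧ s ⬝ᵥ u = 0 ∧ r ⬝ᵥ u = s ⬝ᵥ v}

lemma exists_dotProduct_eq {n : ℕ} {x : Fin n → ℂ} (hx : x ≠ 0) (c : ℂ) :
    ∃ t : Fin n → ℂ, t ⬝ᵥ x = c := by
  obtain ⟨i, hi⟩ := Function.ne_iff.mp hx
  refine ⟨Pi.single i (c / x i), ?_⟩
  rw [single_dotProduct]
  exact div_mul_cancel₀ c hi

lemma vecMulVec_add_vecMul_one_sub_mul {n : ℕ} {E : Mat n} (hE : E * E = E)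
    (u r t : Fin n → ℂ) :
    vecMulVec u (r + t ᵥ* (1 - E)) * E = vecMulVec u r * E := by
  rw [vecMulVec_mul, vecMulVec_mul, add_vecMul, vecMul_vecMul, sub_mul, hE, one_mul, sub_self,
    vecMul_zero, add_zero]

lemma vecMulVec_mem_compress_triangularSet {n : ℕ} {E : Mat n} (hE : E * E = E)
    {u v r s : Fin n → ℂ} (h : E *ᵥ u = u → E *ᵥ v ≠ v ∧ s ⬝ᵥ u = 0) :
    E * (vecMulVec u r + vecMulVec v s) * E ∈ compress E (triangularSet u v) := by
  have key : ∀ p q : Fin n → ℂ, (s + q ᵥ* (1 - E)) ⬝ᵥ u = 0 →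
      (r + p ᵥ* (1 - E)) ⬝ᵥ u = (s + q ᵥ* (1 - E)) ⬝ᵥ v →
      E * (vecMulVec u r + vecMulVec v s) * E ∈ compress E (triangularSet u v) := by
    intro p q h₁ h₂
    refine ⟨_, ⟨_, _, rfl, h₁, h₂⟩, ?_⟩
    simp only [mul_assoc, add_mul, vecMulVec_add_vecMul_one_sub_mul hE]
  have hd : ∀ w t x : Fin n → ℂ, (w + t ᵥ* (1 - E)) ⬝ᵥ x = w ⬝ᵥ x + t ⬝ᵥ (x - E *ᵥ x) := by
    intro w t x
    rw [add_dotProduct, ← dotProduct_mulVec, sub_mulVec, one_mulVec]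
  simp only [hd] at key
  by_cases hu : E *ᵥ u = u
  · obtain ⟨hv, hs⟩ := h hu
    obtain ⟨q, hq⟩ := exists_dotProduct_eq (sub_ne_zero.mpr (Ne.symm hv)) (r ⬝ᵥ u - s ⬝ᵥ v)
    refine key 0 q ?_ ?_
    · simp [hu, hs]
    · simp [hq]
  · have hu' := sub_ne_zero.mpr (Ne.symm hu)
    obtain ⟨q, hq⟩ := exists_dotProduct_eq hu' (-(s ⬝ᵥ u))
    obtain ⟨p, hp⟩ := exists_dotProduct_eq hu' (s ⬝ᵥ v + q ⬝ᵥ (v - E *ᵥ v) - r ⬝ᵥ u)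
    exact key p q (by rw [hq]; ring) (by rw [hp]; ring)

lemma triangularSet_mulClosed {n : ℕ} (u v : Fin n → ℂ) : MulClosed (triangularSet u v) := by
  rintro _ ⟨r, s, rfl, hs, hrs⟩ _ ⟨r', s', rfl, hs', hrs'⟩
  refine ⟨r ᵥ* (vecMulVec u r' + vecMulVec v s'), s ᵥ* (vecMulVec u r' + vecMulVec v s'),
    by simp only [add_mul, vecMulVec_mul], ?_, ?_⟩
  · simp [vecMul_add, vecMul_vecMulVec, hs, hs']
  · simp [vecMul_add, vecMul_vecMulVec, hs, hs', hrs, hrs']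

lemma triangularSet_idempotentCompressible {n : ℕ} (u v : Fin n → ℂ) :
    IdempotentCompressible (triangularSet u v) := by
  rintro E hE _ ⟨M, hM, rfl⟩ _ ⟨N, hN, rfl⟩
  have hprod : E * M * E * (E * N * E) = E * (M * (E * N)) * E := by
    rw [show E * M * E * (E * N * E) = E * M * (E * E) * N * E by noncomm_ring, hE]
    noncomm_ring
  simp only [hprod]
  by_cases huv : E *ᵥ u = u ∧ E *ᵥ v = v
  · have hEN : E * N = N := by
      obtain ⟨r, s, rfl, -, -⟩ := hN
      rw [mul_add, mul_vecMulVec, mul_vecMulVec, huv.1, huv.2]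
    rw [hEN]
    exact ⟨_, triangularSet_mulClosed u v M hM N hN, rfl⟩
  · obtain ⟨r, s, rfl, hs, hrs⟩ := hM
    obtain ⟨r', s', rfl, hs', hrs'⟩ := hN
    rw [add_mul (vecMulVec u r), vecMulVec_mul, vecMulVec_mul]
    refine vecMulVec_mem_compress_triangularSet hE fun hu => ⟨fun hv => huv ⟨hu, hv⟩, ?_⟩
    rw [mul_add, mul_vecMulVec, mul_vecMulVec, hu]
    simp [vecMul_add, vecMul_vecMulVec, hs, hs']

lemma add_mem_triangularSet {n : ℕ} {u v : Fin n → ℂ} {M N : Mat n}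
    (hM : M ∈ triangularSet u v) (hN : N ∈ triangularSet u v) : M + N ∈ triangularSet u v := by
  obtain ⟨r, s, rfl, hs, hrs⟩ := hM
  obtain ⟨r', s', rfl, hs', hrs'⟩ := hN
  refine ⟨r + r', s + s', ?_, ?_, ?_⟩
  · rw [vecMulVec_add, vecMulVec_add]; abel
  · rw [add_dotProduct, hs, hs', add_zero]
  · rw [add_dotProduct, add_dotProduct, hrs, hrs']

lemma smul_mem_triangularSet {n : ℕ} {u v : Fin n → ℂ} {M : Mat n} (c : ℂ)
    (hM : M ∈ triangularSet u v) : c • M ∈ triangularSet u v := by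
  obtain ⟨r, s, rfl, hs, hrs⟩ := hM
  refine ⟨c • r, c • s, ?_, ?_, ?_⟩
  · rw [vecMulVec_smul, vecMulVec_smul, smul_add]
  · rw [smul_dotProduct, hs, smul_zero]
  · rw [smul_dotProduct, smul_dotProduct, hrs]

lemma IdempotentCompressible.unitization {n : ℕ} {A : Set (Mat n)}
    (hA : IdempotentCompressible A) (hadd : ∀ M ∈ A, ∀ N ∈ A, M + N ∈ A)
    (hsmul : ∀ c : ℂ, ∀ M ∈ A, c • M ∈ A) : IdempotentCompressible (unitization A) := by
  rintro E hE _ ⟨_, ⟨M, hM, a, rfl⟩, rfl⟩ _ ⟨_, ⟨N, hN, b, rfl⟩, rfl⟩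
  obtain ⟨L, hL, hLE⟩ := hA E hE _ ⟨M, hM, rfl⟩ _ ⟨N, hN, rfl⟩
  refine ⟨_, ⟨L + a • N + b • M, hadd _ (hadd _ hL _ (hsmul a N hN)) _ (hsmul b M hM),
    a * b, rfl⟩, ?_⟩
  have hexp : ∀ (K : Mat n) (c : ℂ), E * (K + c • 1) * E = E * K * E + c • E := by
    intro K c
    rw [mul_add, add_mul, mul_smul_comm, smul_mul_assoc, mul_one, hE]
  have hl : ∀ K : Mat n, E * (E * K * E) = E * K * E := by
    intro K
    rw [← mul_assoc, ← mul_assoc, hE]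
  have hr : ∀ K : Mat n, E * K * E * E = E * K * E := by
    intro K
    rw [mul_assoc, hE]
  simp only [hexp] at hLE ⊢
  rw [mul_add (E * M * E + a • E), add_mul, add_mul, ← hLE]
  simp only [mul_add, add_mul, mul_smul_comm, smul_mul_assoc, hl, hr, hE, smul_smul]
  rw [mul_comm b a]
  abel

lemma exists_eq_vecMulVec_of_rank_eq_one {n : ℕ} {Q : Mat n} (hQ : Q * Q = Q)
    (hr : Q.rank = 1) : ∃ u f : Fin n → ℂ, Q = vecMulVec u f ∧ f ⬝ᵥ u = 1 := by
  obtain ⟨u, hu, hspan⟩ := finrank_eq_one_iff'.mp hr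
  have hQu : Q *ᵥ (u : Fin n → ℂ) = u := by
    obtain ⟨w, hw⟩ := u.2
    rw [← hw, mulVecLin_apply, mulVec_mulVec, hQ]
  choose f hf using fun j : Fin n => hspan ⟨Q *ᵥ Pi.single j 1, LinearMap.mem_range_self _ _⟩
  have hQf : Q = vecMulVec (u : Fin n → ℂ) f := by
    ext i j
    have h := congrFun (congrArg Subtype.val (hf j)) i
    simp only [mulVec_single_one] at h
    rw [vecMulVec_apply, mul_comm]
    exact h.symm
  refine ⟨u, f, hQf, ?_⟩
  have h : (f ⬝ᵥ (u : Fin n → ℂ)) • (u : Fin n → ℂ) = (1 : ℂ) • (u : Fin n → ℂ) := by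
    rw [one_smul, ← op_smul_eq_smul, ← vecMulVec_mulVec, ← hQf, hQu]
  exact smul_left_injective ℂ (fun h0 => hu (Subtype.ext h0)) h

lemma setOf_eq_triangularSet {n : ℕ} {u v f g : Fin n → ℂ} (hfu : f ⬝ᵥ u = 1)
    (hgv : g ⬝ᵥ v = 1) (hfv : f ⬝ᵥ v = 0) (hgu : g ⬝ᵥ u = 0) {Q₁ Q₂ Q₃ : Mat n}
    (hQ₁ : Q₁ = vecMulVec u f) (hQ₂ : Q₂ = vecMulVec v g) (hQ₃ : Q₃ = 1 - Q₁ - Q₂) :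
    {M : Mat n | ∃ (α : ℂ) (S T : Mat n), M = α • (Q₁ + Q₂) + Q₁ * S * Q₂ + (Q₁ + Q₂) * T * Q₃} =
      triangularSet u v := by
  have hu : Q₃ *ᵥ u = 0 := by
    simp [hQ₃, hQ₁, hQ₂, sub_mulVec, vecMulVec_mulVec, hfu, hgu]
  have hv : Q₃ *ᵥ v = 0 := by
    simp [hQ₃, hQ₁, hQ₂, sub_mulVec, vecMulVec_mulVec, hfv, hgv]
  have hu₂ : Q₂ *ᵥ u = 0 := by
    simp [hQ₂, vecMulVec_mulVec, hgu]
  ext M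
  constructor
  · rintro ⟨α, S, T, rfl⟩
    refine ⟨α • f + f ᵥ* (S * Q₂) + f ᵥ* (T * Q₃), α • g + g ᵥ* (T * Q₃), ?_, ?_, ?_⟩
    · simp only [vecMulVec_add, vecMulVec_smul, ← vecMulVec_mul, ← hQ₁, ← hQ₂, mul_assoc,
        add_mul, smul_add]
      abel
    · simp [add_dotProduct, ← dotProduct_mulVec, ← mulVec_mulVec, hu, hgu]
    · simp [add_dotProduct, ← dotProduct_mulVec, ← mulVec_mulVec, hu, hv, hu₂, hfu, hgv]
  · rintro ⟨r, s, rfl, hs, hrs⟩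
    refine ⟨r ⬝ᵥ u, vecMulVec u r, vecMulVec u r + vecMulVec v s, ?_⟩
    have h : (Q₁ + Q₂) * (vecMulVec u r + vecMulVec v s) = vecMulVec u r + vecMulVec v s := by
      simp [hQ₁, hQ₂, mul_add, mul_vecMulVec, add_mulVec, vecMulVec_mulVec, hfu, hgv, hfv, hgu]
    rw [h, hQ₃, hQ₁, hQ₂]
    simp only [mul_sub, mul_one, add_mul, vecMulVec_mul, vecMul_vecMulVec, vecMulVec_smul,
      hfu, hs, ← hrs, smul_add, one_smul, zero_smul, vecMulVec_zero]
    abel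

/-- Example 3.1.6: `ℂ(Q₁+Q₂) + Q₁ Mₙ(ℂ) Q₂ + (Q₁+Q₂) Mₙ(ℂ) Q₃` is idempotent
compressible, and so is its unitization. -/
theorem example_3_1_6 {n : ℕ} (hn : 3 ≤ n) (Q₁ Q₂ Q₃ : Mat n)
    (hQ₁ : Q₁ * Q₁ = Q₁) (hQ₁' : Q₁ᴴ = Q₁) (hQ₁r : Q₁.rank = 1)
    (hQ₂ : Q₂ * Q₂ = Q₂) (hQ₂' : Q₂ᴴ = Q₂) (hQ₂r : Q₂.rank = 1)
    (horth : Q₁ * Q₂ = 0 ∧ Q₂ * Q₁ = 0)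
    (hQ₃ : Q₃ = 1 - Q₁ - Q₂) :
    IdempotentCompressible {M : Mat n | ∃ (α : ℂ) (S T : Mat n), M = α • (Q₁ + Q₂) + Q₁ * S * Q₂ + (Q₁ + Q₂) * T * Q₃} ∧
    IdempotentCompressible (unitization {M : Mat n | ∃ (α : ℂ) (S T : Mat n), M = α • (Q₁ + Q₂) + Q₁ * S * Q₂ + (Q₁ + Q₂) * T * Q₃}) := by
  obtain ⟨u, f, h₁, hfu⟩ := exists_eq_vecMulVec_of_rank_eq_one hQ₁ hQ₁r
  obtain ⟨v, g, h₂, hgv⟩ := exists_eq_vecMulVec_of_rank_eq_one hQ₂ hQ₂r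
  have hdot : ∀ {a b c d : Fin n → ℂ}, b ⬝ᵥ a = 1 → d ⬝ᵥ c = 1 →
      vecMulVec a b * vecMulVec c d = 0 → b ⬝ᵥ c = 0 := by
    intro a b c d hab hcd h
    simpa [← mulVec_mulVec, vecMulVec_mulVec, dotProduct_smul, hab, hcd] using
      congrArg (fun M : Mat n => b ⬝ᵥ M *ᵥ c) h
  have hfv : f ⬝ᵥ v = 0 := hdot hfu hgv (h₁ ▸ h₂ ▸ horth.1)
  have hgu : g ⬝ᵥ u = 0 := hdot hgv hfu (h₁ ▸ h₂ ▸ horth.2)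
  rw [setOf_eq_triangularSet hfu hgv hfv hgu h₁ h₂ hQ₃]
  exact ⟨triangularSet_idempotentCompressible u v,
    (triangularSet_idempotentCompressible u v).unitization
      (fun _ hM _ hN => add_mem_triangularSet hM hN) fun c _ hM => smul_mem_triangularSet c hM⟩
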